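/- arXiv:2503.18443 — 2 statements merged into one kernel-verified Lean document; each statement's English description precedes it below -/
import Mathlib

section
/- Strict convexity of the dual value function in the intermediate region: for all h₁ ≥ h₂ > 0 and every y with h₁^{−γ} ≤ y ≤ h₂^{−γ}, one has m₁(m₁−1)·C₃(h₂)·y^{m₁−γ*} + m₂(m₂−1)·C₄(h₁)·y^{m₂−γ*} + 2(γ*−1)/(κ²(γ*−m₁)(γ*−m₂)) > 0. -/
/-- Coefficient `C₂(h)`. -/
noncomputable def C2 (r δ κ γ m₁ m₂ α zα : ℝ) (h : ℝ) : ℝ :=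
  (1 - (γ - 1) / γ) / ((m₁ - m₂) * (m₂ - (γ - 1) / γ)) *
    (m₁ * (α * δ - 1) / δ * zα ^ (-m₂) + (m₁ - 1) / r * zα ^ (1 - m₂)) *
    h ^ (1 + γ * (m₂ - 1))

/-- Coefficient `C₅(h)`. -/
noncomputable def C5 (r δ κ γ m₁ m₂ β zβ : ℝ) (h : ℝ) : ℝ :=
  (1 - (γ - 1) / γ) / ((m₁ - m₂) * (m₁ - (γ - 1) / γ)) *
    (m₂ * (β * δ + 1) / δ * zβ ^ (-m₁) + (1 - m₂) / r * zβ ^ (1 - m₁)) *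
    h ^ (1 + γ * (m₁ - 1))

/-- Coefficient `C₃(h)`. -/
noncomputable def C3 (r δ κ γ m₁ m₂ β zβ : ℝ) (h : ℝ) : ℝ :=
  C5 r δ κ γ m₁ m₂ β zβ h +
    2 * ((γ - 1) / γ - 1) / (κ ^ 2 * (m₁ - m₂) * m₁ * (m₁ - 1) * (m₁ - (γ - 1) / γ)) *
      h ^ (1 + γ * (m₁ - 1))

/-- Coefficient `C₄(h)`. -/
noncomputable def C4 (r δ κ γ m₁ m₂ α zα : ℝ) (h : ℝ) : ℝ :=
  C2 r δ κ γ m₁ m₂ α zα h -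
    2 * ((γ - 1) / γ - 1) / (κ ^ 2 * (m₁ - m₂) * m₂ * (m₂ - 1) * (m₂ - (γ - 1) / γ)) *
      h ^ (1 + γ * (m₂ - 1))

/-- Coefficient `C₁(h₁,h₂)`. -/
noncomputable def C1 (r δ κ γ m₁ m₂ β zβ : ℝ) (h₁ h₂ : ℝ) : ℝ :=
  C3 r δ κ γ m₁ m₂ β zβ h₂ +
    2 * (1 - (γ - 1) / γ) / (κ ^ 2 * (m₁ - m₂) * m₁ * (m₁ - 1) * (m₁ - (γ - 1) / γ)) *
      h₁ ^ (1 + γ * (m₁ - 1))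

/-- Coefficient `C₆(h₁,h₂)`. -/
noncomputable def C6 (r δ κ γ m₁ m₂ α zα : ℝ) (h₁ h₂ : ℝ) : ℝ :=
  C4 r δ κ γ m₁ m₂ α zα h₁ -
    2 * (1 - (γ - 1) / γ) / (κ ^ 2 * (m₁ - m₂) * m₂ * (m₂ - 1) * (m₂ - (γ - 1) / γ)) *
      h₂ ^ (1 + γ * (m₂ - 1))

theorem vieta_aux (r δ κ m₁ m₂ : ℝ)
    (hQ1 : κ ^ 2 / 2 * m₁ ^ 2 + (δ - r - κ ^ 2 / 2) * m₁ - δ = 0)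
    (hQ2 : κ ^ 2 / 2 * m₂ ^ 2 + (δ - r - κ ^ 2 / 2) * m₂ - δ = 0)
    (hne : m₁ - m₂ ≠ 0) :
    δ = -(κ ^ 2 / 2 * m₁ * m₂) ∧ r = κ ^ 2 / 2 * (m₁ - 1) * (1 - m₂) := by
  have h1 : κ ^ 2 / 2 * (m₁ + m₂) + (δ - r - κ ^ 2 / 2) = 0 := by
    apply mul_left_cancel₀ hne
    linear_combination hQ1 - hQ2
  constructor
  · linear_combination m₁ * h1 - hQ1
  · linear_combination (m₁ - 1) * h1 - hQ1

theorem rpow_bound_aux (h γ y m g : ℝ) (hh : 0 < h) (hg : γ * (1 - g) = 1)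
    (hle : y ^ (m - g) ≤ (h ^ (-γ)) ^ (m - g)) :
    h ^ (1 + γ * (m - 1)) * y ^ (m - g) ≤ 1 := by
  have hp : 0 < h ^ (1 + γ * (m - 1)) := Real.rpow_pos_of_pos hh _
  calc h ^ (1 + γ * (m - 1)) * y ^ (m - g)
      ≤ h ^ (1 + γ * (m - 1)) * (h ^ (-γ)) ^ (m - g) := by gcongr
    _ = 1 := by
      rw [← Real.rpow_mul hh.le, ← Real.rpow_add hh]
      have : 1 + γ * (m - 1) + -γ * (m - g) = 0 := by linear_combination -hg
      rw [this, Real.rpow_zero]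

/-- Strict convexity of the dual value function in the intermediate
region: for all `h₁ ≥ h₂ > 0` and every `y` with `h₁^{−γ} ≤ y ≤ h₂^{−γ}`, one has
`m₁(m₁−1)·C₃(h₂)·y^{m₁−γ*} + m₂(m₂−1)·C₄(h₁)·y^{m₂−γ*}
  + 2(γ*−1)/(κ²(γ*−m₁)(γ*−m₂)) > 0`. -/
theorem dual_value_strict_convex_middle (r δ κ γ m₁ m₂ α β zα zβ : ℝ)
    (hr : 0 < r) (hδ : 0 < δ) (hκ : 0 < κ) (hγ : 0 < γ) (hγ1 : γ ≠ 1)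
    (hK : 0 < r + (δ - r) / γ + ((γ - 1) / (2 * γ ^ 2)) * κ ^ 2)
    (hQ1 : κ ^ 2 / 2 * m₁ ^ 2 + (δ - r - κ ^ 2 / 2) * m₁ - δ = 0)
    (hQ2 : κ ^ 2 / 2 * m₂ ^ 2 + (δ - r - κ ^ 2 / 2) * m₂ - δ = 0)
    (hm1 : 1 < m₁) (hm2 : m₂ < min ((γ - 1) / γ) 0)
    (hα : 0 ≤ α) (hα' : α < 1 / δ) (hβ : 0 ≤ β)
    (hzα : zα ∈ Set.Ioc 0 (1 - α * δ))
    (hzαeq : 2 / (κ ^ 2 * m₁ * (m₁ - 1)) * zα ^ m₁ + zα / r * (m₂ - 1) + m₂ * (α - 1 / δ) = 0)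
    (hzβ : zβ ∈ Set.Ici (1 + β * δ))
    (hzβeq : 2 / (κ ^ 2 * m₂ * (m₂ - 1)) * zβ ^ m₂ + zβ / r * (m₁ - 1) - m₁ * (β + 1 / δ) = 0)
    :
    ∀ h₁ h₂ : ℝ, 0 < h₂ → h₂ ≤ h₁ →
      ∀ y : ℝ, h₁ ^ (-γ) ≤ y → y ≤ h₂ ^ (-γ) →
        0 < m₁ * (m₁ - 1) * C3 r δ κ γ m₁ m₂ β zβ h₂ * y ^ (m₁ - (γ - 1) / γ) +
              m₂ * (m₂ - 1) * C4 r δ κ γ m₁ m₂ α zα h₁ * y ^ (m₂ - (γ - 1) / γ) +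
              2 * ((γ - 1) / γ - 1) /
                (κ ^ 2 * ((γ - 1) / γ - m₁) * ((γ - 1) / γ - m₂)) := by
  intro h₁ h₂ hh₂ h21 y hy1 hy2
  have hh₁ : 0 < h₁ := lt_of_lt_of_le hh₂ h21
  have hy : 0 < y := lt_of_lt_of_le (Real.rpow_pos_of_pos hh₁ _) hy1
  obtain ⟨hm2g, hm20⟩ := lt_min_iff.mp hm2
  obtain ⟨hzα0, hzα1⟩ := hzα
  have hzβ1 : 1 + β * δ ≤ zβ := hzβ
  have hb : 0 < 1 + β * δ := by positivity
  have hzβ0 : 0 < zβ := lt_of_lt_of_le hb hzβ1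
  obtain ⟨hδe, hre⟩ := vieta_aux r δ κ m₁ m₂ hQ1 hQ2 (by intro h0; linarith)
  have hgγ : γ * (1 - (γ - 1) / γ) = 1 := by field_simp; ring
  have hg1 : (γ - 1) / γ < 1 := by rw [div_lt_one hγ]; linarith
  unfold C3 C4 C5 C2
  generalize (γ - 1) / γ = g at *
  have hP1 := rpow_bound_aux h₂ γ y m₁ g hh₂ hgγ
    (Real.rpow_le_rpow hy.le hy2 (by linarith))
  have hR1 := rpow_bound_aux h₁ γ y m₂ g hh₁ hgγ
    (Real.rpow_le_rpow_of_nonpos (Real.rpow_pos_of_pos hh₁ _) hy1 (by linarith))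
  have hP0 : 0 < h₂ ^ (1 + γ * (m₁ - 1)) * y ^ (m₁ - g) := by positivity
  have hR0 : 0 < h₁ ^ (1 + γ * (m₂ - 1)) * y ^ (m₂ - g) := by positivity
  have hW : zβ ^ (1 - m₁) = zβ * zβ ^ (-m₁) := by
    rw [sub_eq_add_neg, Real.rpow_add hzβ0, Real.rpow_one]
  have hV : zα ^ (1 - m₂) = zα * zα ^ (-m₂) := by
    rw [sub_eq_add_neg, Real.rpow_add hzα0, Real.rpow_one]
  have hW0 : 0 < zβ ^ (-m₁) := Real.rpow_pos_of_pos hzβ0 _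
  have hV0 : 0 < zα ^ (-m₂) := Real.rpow_pos_of_pos hzα0 _
  rw [hW, hV]
  generalize zβ ^ (-m₁) = W at *
  generalize zα ^ (-m₂) = V at *
  generalize h₂ ^ (1 + γ * (m₁ - 1)) = p at *
  generalize h₁ ^ (1 + γ * (m₂ - 1)) = q at *
  generalize y ^ (m₁ - g) = u at *
  generalize y ^ (m₂ - g) = v at *
  have hB : 0 < W * (m₁ * zβ - (m₁ - 1) * (1 + β * δ)) := by
    apply mul_pos hW0
    linarith [mul_nonneg (sub_nonneg.mpr hm1.le) (sub_nonneg.mpr hzβ1)]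
  have hA : 0 < V * ((1 - m₂) * (1 - α * δ) + m₂ * zα) := by
    apply mul_pos hV0
    linarith [mul_nonneg (neg_nonneg.mpr hm20.le) (sub_nonneg.mpr hzα1)]
  have n1 : m₁ ≠ 0 := by intro h0; linarith
  have n2 : m₂ ≠ 0 := by intro h0; linarith
  have n3 : m₁ - 1 ≠ 0 := by intro h0; linarith
  have n4 : 1 - m₂ ≠ 0 := by intro h0; linarith
  have n4' : m₂ - 1 ≠ 0 := by intro h0; linarith
  have p5 : 0 < m₁ - m₂ := by linarith
  have p6 : 0 < m₁ - g := by linarith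
  have p7 : 0 < g - m₂ := by linarith
  have p8 : 0 < 1 - g := by linarith
  have n6 : g - m₁ ≠ 0 := by intro h0; linarith
  have n7 : m₂ - g ≠ 0 := by intro h0; linarith
  have e1 : m₁ * (m₁ - 1) * (m₂ * (β * δ + 1) / δ * W + (1 - m₂) / r * (zβ * W)) =
      2 / κ ^ 2 * (W * (m₁ * zβ - (m₁ - 1) * (1 + β * δ))) := by
    have a1 : m₁ * m₂ / δ = -(2 / κ ^ 2) := by
      rw [hδe]; field_simp
    have a2 : (m₁ - 1) * (1 - m₂) / r = 2 / κ ^ 2 := by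
      rw [hre]; field_simp
    linear_combination (m₁ - 1) * (β * δ + 1) * W * a1 + m₁ * zβ * W * a2
  have e2 : m₂ * (m₂ - 1) * (m₁ * (α * δ - 1) / δ * V + (m₁ - 1) / r * (zα * V)) =
      - (2 / κ ^ 2 * (V * ((1 - m₂) * (1 - α * δ) + m₂ * zα))) := by
    have a1 : m₁ * m₂ / δ = -(2 / κ ^ 2) := by
      rw [hδe]; field_simp
    have a2 : (m₁ - 1) * (1 - m₂) / r = 2 / κ ^ 2 := by
      rw [hre]; field_simp
    linear_combination (m₂ - 1) * (α * δ - 1) * V * a1 - m₂ * zα * V * a2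
  generalize m₂ * (β * δ + 1) / δ * W + (1 - m₂) / r * (zβ * W) = X at *
  generalize m₁ * (α * δ - 1) / δ * V + (m₁ - 1) / r * (zα * V) = Y at *
  generalize W * (m₁ * zβ - (m₁ - 1) * (1 + β * δ)) = B at *
  generalize V * ((1 - m₂) * (1 - α * δ) + m₂ * zα) = A at *
  have f1 : m₁ * (m₁ - 1) * ((1 - g) / ((m₁ - m₂) * (m₁ - g)) * X * p +
      2 * (g - 1) / (κ ^ 2 * (m₁ - m₂) * m₁ * (m₁ - 1) * (m₁ - g)) * p) * u =
      2 * (1 - g) / (κ ^ 2 * (m₁ - m₂) * (m₁ - g)) * ((B - 1) * (p * u)) := by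
    have : m₁ * (m₁ - 1) * (2 * (g - 1) / (κ ^ 2 * (m₁ - m₂) * m₁ * (m₁ - 1) * (m₁ - g)))
        = - (2 * (1 - g) / (κ ^ 2 * (m₁ - m₂) * (m₁ - g))) := by
      field_simp; ring
    have e : 2 * (1 - g) / (κ ^ 2 * (m₁ - m₂) * (m₁ - g)) =
        (1 - g) / ((m₁ - m₂) * (m₁ - g)) * (2 / κ ^ 2) := by field_simp
    linear_combination (1 - g) / ((m₁ - m₂) * (m₁ - g)) * p * u * e1 + p * u * this
      - B * p * u * e
  have f2 : m₂ * (m₂ - 1) * ((1 - g) / ((m₁ - m₂) * (m₂ - g)) * Y * q -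
      2 * (g - 1) / (κ ^ 2 * (m₁ - m₂) * m₂ * (m₂ - 1) * (m₂ - g)) * q) * v =
      2 * (1 - g) / (κ ^ 2 * (m₁ - m₂) * (g - m₂)) * ((A - 1) * (q * v)) := by
    have hneg : m₂ - g = -(g - m₂) := by ring
    rw [hneg]
    have : m₂ * (m₂ - 1) * (2 * (g - 1) / (κ ^ 2 * (m₁ - m₂) * m₂ * (m₂ - 1) * -(g - m₂)))
        = (2 * (1 - g) / (κ ^ 2 * (m₁ - m₂) * (g - m₂))) := by
      field_simp; ring
    have e : 2 * (1 - g) / (κ ^ 2 * (m₁ - m₂) * (g - m₂)) =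
        - ((1 - g) / ((m₁ - m₂) * -(g - m₂))) * (2 / κ ^ 2) := by field_simp
    linear_combination (1 - g) / ((m₁ - m₂) * -(g - m₂)) * q * v * e2 - q * v * this
      - A * q * v * e
  rw [f1, f2]
  generalize p * u = P at *
  generalize q * v = R at *
  have f3 : 2 * (1 - g) / (κ ^ 2 * (m₁ - m₂) * (m₁ - g)) * ((B - 1) * P) +
      2 * (1 - g) / (κ ^ 2 * (m₁ - m₂) * (g - m₂)) * ((A - 1) * R) +
      2 * (g - 1) / (κ ^ 2 * (g - m₁) * (g - m₂)) =
      2 * (1 - g) / (κ ^ 2 * (m₁ - m₂) * (m₁ - g) * (g - m₂)) *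
        ((g - m₂) * ((B - 1) * P) + (m₁ - g) * ((A - 1) * R) + (m₁ - m₂)) := by
    have hneg : g - m₁ = -(m₁ - g) := by ring
    rw [hneg]
    field_simp
    ring
  rw [f3]
  have i1 : 0 < (g - m₂) * ((B - 1) * P + 1) := by
    apply mul_pos p7
    linarith [mul_pos hB hP0]
  have i2 : 0 < (m₁ - g) * ((A - 1) * R + 1) := by
    apply mul_pos p6
    linarith [mul_pos hA hR0]
  apply mul_pos (by positivity)
  linarith
end

section
/- Smooth pasting of the candidate dual value function: for h₁ ≥ h₂ > 0, define on (0,∞) the three branches v₁(y) = C₁(h₁,h₂)y^{m₁} + C₂(h₁)y^{m₂} + h₁^{1−γ}/(δ(1−γ)) − y h₁/r, v₂(y) = C₃(h₂)y^{m₁} + C₄(h₁)y^{m₂} + (2/(κ²γ*(γ*−m₁)(γ*−m₂))) y^{γ*}, and v₃(y) = C₅(h₂)y^{m₁} + C₆(h₁,h₂)y^{m₂} + h₂^{1−γ}/(δ(1−γ)) − y h₂/r. Then v₁(h₁^{−γ}) = v₂(h₁^{−γ}), v₁'(h₁^{−γ}) = v₂'(h₁^{−γ}), v₂(h₂^{−γ})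 = v₃(h₂^{−γ}), and v₂'(h₂^{−γ}) = v₃'(h₂^{−γ}). -/
/-- Pasting of one pair of branches at `h ^ (-γ)`, given the coefficient jumps. -/
lemma paste_aux (r δ κ γ m₁ m₂ g : ℝ) (hg : g = (γ - 1) / γ)
    (hr : 0 < r) (hδ : 0 < δ) (hκ : 0 < κ) (hγ : 0 < γ) (hγ1 : γ ≠ 1)
    (hQ1 : κ ^ 2 / 2 * m₁ ^ 2 + (δ - r - κ ^ 2 / 2) * m₁ - δ = 0)
    (hQ2 : κ ^ 2 / 2 * m₂ ^ 2 + (δ - r - κ ^ 2 / 2) * m₂ - δ = 0)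
    (hm1 : 1 < m₁) (hm2 : m₂ < g) (hm20 : m₂ < 0) (h a b c d : ℝ) (hh : 0 < h)
    (hac : a = c + 2 * (1 - g) / (κ ^ 2 * (m₁ - m₂) * m₁ * (m₁ - 1) * (m₁ - g)) *
      h ^ (1 + γ * (m₁ - 1)))
    (hbd : b = d - 2 * (1 - g) / (κ ^ 2 * (m₁ - m₂) * m₂ * (m₂ - 1) * (m₂ - g)) *
      h ^ (1 + γ * (m₂ - 1))) :
    (a * (h ^ (-γ)) ^ m₁ + b * (h ^ (-γ)) ^ m₂ +
        h ^ (1 - γ) / (δ * (1 - γ)) - (h ^ (-γ)) * h / r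
      = c * (h ^ (-γ)) ^ m₁ + d * (h ^ (-γ)) ^ m₂ +
        2 / (κ ^ 2 * g * (g - m₁) * (g - m₂)) * (h ^ (-γ)) ^ g) ∧
    deriv (fun y : ℝ => a * y ^ m₁ + b * y ^ m₂ +
        h ^ (1 - γ) / (δ * (1 - γ)) - y * h / r) (h ^ (-γ))
      = deriv (fun y : ℝ => c * y ^ m₁ + d * y ^ m₂ +
        2 / (κ ^ 2 * g * (g - m₁) * (g - m₂)) * y ^ g) (h ^ (-γ)) := by
  have hg1 : g = 1 - 1 / γ := by rw [hg]; field_simp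
  have hgl : g < 1 := by have : 0 < 1 / γ := by positivity
                         linarith
  have hg0 : g ≠ 0 := by rw [hg]; exact div_ne_zero (sub_ne_zero.2 hγ1) hγ.ne'
  have hγg : 1 - γ = - g / (1 - g) := by rw [hg]; field_simp; ring
  have e1 : m₁ ≠ 0 := by linarith
  have e2 : m₂ ≠ 0 := hm20.ne
  have e3 : m₁ - 1 ≠ 0 := by linarith
  have e4 : m₂ - 1 ≠ 0 := by linarith
  have e5 : m₁ - m₂ ≠ 0 := by linarith
  have e6 : m₁ - g ≠ 0 := by linarith
  have e7 : m₂ - g ≠ 0 := by linarith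
  have e8 : g - m₁ ≠ 0 := by linarith
  have e9 : g - m₂ ≠ 0 := by linarith
  have e10 : 1 - g ≠ 0 := by linarith
  have hsum : κ ^ 2 / 2 * (m₁ + m₂) + (δ - r - κ ^ 2 / 2) = 0 := by
    apply mul_left_cancel₀ e5
    linear_combination hQ1 - hQ2
  have hδe : δ = - (κ ^ 2 / 2) * m₁ * m₂ := by
    linear_combination m₁ * hsum - hQ1
  have hre : r = - (κ ^ 2 / 2) * (m₁ - 1) * (m₂ - 1) := by
    linear_combination hδe - hsum
  have id1 : 2 * (1 - g) / (κ ^ 2 * (m₁ - m₂) * m₁ * (m₁ - 1) * (m₁ - g)) -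
      2 * (1 - g) / (κ ^ 2 * (m₁ - m₂) * m₂ * (m₂ - 1) * (m₂ - g)) + 1 / (δ * (1 - γ)) - 1 / r
      = 2 / (κ ^ 2 * g * (g - m₁) * (g - m₂)) := by
    rw [hγg, hδe, hre, ← neg_sub m₁ g, ← neg_sub m₂ g]
    field_simp
    ring
  have id2 : m₁ * (2 * (1 - g) / (κ ^ 2 * (m₁ - m₂) * m₁ * (m₁ - 1) * (m₁ - g))) -
      m₂ * (2 * (1 - g) / (κ ^ 2 * (m₁ - m₂) * m₂ * (m₂ - 1) * (m₂ - g))) - 1 / r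
      = g * (2 / (κ ^ 2 * g * (g - m₁) * (g - m₂))) := by
    rw [hre, ← neg_sub m₁ g, ← neg_sub m₂ g]
    field_simp
    ring
  have p1 : ∀ m : ℝ, h ^ (1 + γ * (m - 1)) * (h ^ (-γ)) ^ m = h ^ (1 - γ) := by
    intro m
    rw [← Real.rpow_mul hh.le, ← Real.rpow_add hh]
    congr 1; ring
  have p2 : (h ^ (-γ)) ^ g = h ^ (1 - γ) := by
    rw [← Real.rpow_mul hh.le]
    congr 1; rw [hg]; field_simp; ring
  have p3 : h ^ (-γ) * h = h ^ (1 - γ) := by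
    conv_lhs => rw [← Real.rpow_one h, ← Real.rpow_mul hh.le, ← Real.rpow_add hh]
    congr 1; ring
  have hy : 0 < h ^ (-γ) := Real.rpow_pos_of_pos hh _
  have q1 := p1 m₁
  have q2 := p1 m₂
  generalize 2 * (1 - g) / (κ ^ 2 * (m₁ - m₂) * m₁ * (m₁ - 1) * (m₁ - g)) = A at *
  generalize 2 * (1 - g) / (κ ^ 2 * (m₁ - m₂) * m₂ * (m₂ - 1) * (m₂ - g)) = B at *
  generalize 2 / (κ ^ 2 * g * (g - m₁) * (g - m₂)) = D at *
  constructor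
  · rw [hac, hbd, p2, p3]
    linear_combination A * q1 - B * q2 + h ^ (1 - γ) * id1
  · have d0 : ∀ m : ℝ, HasDerivAt (fun y : ℝ => y ^ m) (m * (h ^ (-γ)) ^ (m - 1)) (h ^ (-γ)) :=
      fun m => Real.hasDerivAt_rpow_const (Or.inl hy.ne')
    have L := ((((d0 m₁).const_mul a).add ((d0 m₂).const_mul b)).add_const
      (h ^ (1 - γ) / (δ * (1 - γ)))).sub (((hasDerivAt_id (h ^ (-γ))).mul_const h).div_const r)
    have R := (((d0 m₁).const_mul c).add ((d0 m₂).const_mul d)).add ((d0 g).const_mul D)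
    refine L.deriv.trans (Eq.trans ?_ R.deriv.symm)
    apply mul_right_cancel₀ hy.ne'
    have s : ∀ m : ℝ, (h ^ (-γ)) ^ (m - 1) * h ^ (-γ) = (h ^ (-γ)) ^ m := by
      intro m
      rw [Real.rpow_sub_one hy.ne']; field_simp
    have s1 := s m₁
    have s2 := s m₂
    have s3 := s g
    rw [p2] at s3
    rw [hac, hbd]
    generalize h ^ (1 + γ * (m₁ - 1)) = H1 at *
    generalize h ^ (1 + γ * (m₂ - 1)) = H2 at *
    linear_combination A * H1 * m₁ * s1 - B * H2 * m₂ * s2 - D * g * s3 + A * m₁ * q1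
      - B * m₂ * q2 - p3 / r + h ^ (1 - γ) * id2

/-- Smooth pasting of the three branches of the candidate dual value
function at the points `y = h₁^{−γ}` and `y = h₂^{−γ}`. -/
theorem dual_smooth_pasting (r δ κ γ m₁ m₂ α β zα zβ : ℝ)
    (hr : 0 < r) (hδ : 0 < δ) (hκ : 0 < κ) (hγ : 0 < γ) (hγ1 : γ ≠ 1)
    (hK : 0 < r + (δ - r) / γ + ((γ - 1) / (2 * γ ^ 2)) * κ ^ 2)
    (hQ1 : κ ^ 2 / 2 * m₁ ^ 2 + (δ - r - κ ^ 2 / 2) * m₁ - δ = 0)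
    (hQ2 : κ ^ 2 / 2 * m₂ ^ 2 + (δ - r - κ ^ 2 / 2) * m₂ - δ = 0)
    (hm1 : 1 < m₁) (hm2 : m₂ < min ((γ - 1) / γ) 0)
    (hα : 0 ≤ α) (hα' : α < 1 / δ) (hβ : 0 ≤ β)
    (hzα : zα ∈ Set.Ioc 0 (1 - α * δ))
    (hzαeq : 2 / (κ ^ 2 * m₁ * (m₁ - 1)) * zα ^ m₁ + zα / r * (m₂ - 1) + m₂ * (α - 1 / δ) = 0)
    (hzβ : zβ ∈ Set.Ici (1 + β * δ))
    (hzβeq : 2 / (κ ^ 2 * m₂ * (m₂ - 1)) * zβ ^ m₂ + zβ / r * (m₁ - 1) - m₁ * (β + 1 / δ) = 0)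
    :
    ∀ h₁ h₂ : ℝ, 0 < h₂ → h₂ ≤ h₁ →
      (fun y : ℝ => C1 r δ κ γ m₁ m₂ β zβ h₁ h₂ * y ^ m₁ + C2 r δ κ γ m₁ m₂ α zα h₁ * y ^ m₂ +
            h₁ ^ (1 - γ) / (δ * (1 - γ)) - y * h₁ / r) (h₁ ^ (-γ))
        = (fun y : ℝ => C3 r δ κ γ m₁ m₂ β zβ h₂ * y ^ m₁ + C4 r δ κ γ m₁ m₂ α zα h₁ * y ^ m₂ +
            2 / (κ ^ 2 * ((γ - 1) / γ) * ((γ - 1) / γ - m₁) * ((γ - 1) / γ - m₂)) *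
              y ^ ((γ - 1) / γ)) (h₁ ^ (-γ)) ∧
      deriv (fun y : ℝ => C1 r δ κ γ m₁ m₂ β zβ h₁ h₂ * y ^ m₁ + C2 r δ κ γ m₁ m₂ α zα h₁ * y ^ m₂ +
            h₁ ^ (1 - γ) / (δ * (1 - γ)) - y * h₁ / r) (h₁ ^ (-γ))
        = deriv (fun y : ℝ => C3 r δ κ γ m₁ m₂ β zβ h₂ * y ^ m₁ + C4 r δ κ γ m₁ m₂ α zα h₁ * y ^ m₂ +
            2 / (κ ^ 2 * ((γ - 1) / γ) * ((γ - 1) / γ - m₁) * ((γ - 1) / γ - m₂)) *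
              y ^ ((γ - 1) / γ)) (h₁ ^ (-γ)) ∧
      (fun y : ℝ => C3 r δ κ γ m₁ m₂ β zβ h₂ * y ^ m₁ + C4 r δ κ γ m₁ m₂ α zα h₁ * y ^ m₂ +
            2 / (κ ^ 2 * ((γ - 1) / γ) * ((γ - 1) / γ - m₁) * ((γ - 1) / γ - m₂)) *
              y ^ ((γ - 1) / γ)) (h₂ ^ (-γ))
        = (fun y : ℝ => C5 r δ κ γ m₁ m₂ β zβ h₂ * y ^ m₁ + C6 r δ κ γ m₁ m₂ α zα h₁ h₂ * y ^ m₂ +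
            h₂ ^ (1 - γ) / (δ * (1 - γ)) - y * h₂ / r) (h₂ ^ (-γ)) ∧
      deriv (fun y : ℝ => C3 r δ κ γ m₁ m₂ β zβ h₂ * y ^ m₁ + C4 r δ κ γ m₁ m₂ α zα h₁ * y ^ m₂ +
            2 / (κ ^ 2 * ((γ - 1) / γ) * ((γ - 1) / γ - m₁) * ((γ - 1) / γ - m₂)) *
              y ^ ((γ - 1) / γ)) (h₂ ^ (-γ))
        = deriv (fun y : ℝ => C5 r δ κ γ m₁ m₂ β zβ h₂ * y ^ m₁ + C6 r δ κ γ m₁ m₂ α zα h₁ h₂ * y ^ m₂ +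
            h₂ ^ (1 - γ) / (δ * (1 - γ)) - y * h₂ / r) (h₂ ^ (-γ)) := by
  intro h₁ h₂ hh2 h21
  have hh1 : 0 < h₁ := hh2.trans_le h21
  obtain ⟨hm2g, hm20⟩ := lt_min_iff.1 hm2
  have P := paste_aux r δ κ γ m₁ m₂ _ rfl hr hδ hκ hγ hγ1 hQ1 hQ2 hm1 hm2g hm20 h₁
    (C1 r δ κ γ m₁ m₂ β zβ h₁ h₂) (C2 r δ κ γ m₁ m₂ α zα h₁)
    (C3 r δ κ γ m₁ m₂ β zβ h₂) (C4 r δ κ γ m₁ m₂ α zα h₁) hh1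
    (by rw [C1]) (by rw [C4]; ring)
  have P' := paste_aux r δ κ γ m₁ m₂ _ rfl hr hδ hκ hγ hγ1 hQ1 hQ2 hm1 hm2g hm20 h₂
    (C5 r δ κ γ m₁ m₂ β zβ h₂) (C6 r δ κ γ m₁ m₂ α zα h₁ h₂)
    (C3 r δ κ γ m₁ m₂ β zβ h₂) (C4 r δ κ γ m₁ m₂ α zα h₁) hh2
    (by rw [C3]; ring) (by rw [C6])
  exact ⟨P.1, P.2, P'.1.symm, P'.2.symm⟩
end
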